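/- Let K be a field of characteristic zero and let R₂ be the quotient of the free associative algebra on two generators A₀, A₁ over K by the two-sided ideal generated by all products of three generators. Let a, b, c, m, r ∈ K satisfy c + r = a·b. Then the following identity holds in R₂: 1 + a·A₀ + b·A₁ + (a²/2)·A₀A₀ + (c + m)·A₀A₁ + (r − m)·A₁A₀ + (b²/2)·A₁A₁ = exp₂(b·A₁) · exp₂(a·A₀ + (c + m)·[A₀,A₁]). (This is the factorization underlying the level-2 de Rham unipotent Albanese map on an elliptic curve with tangential basepoint b at infinity, with a = ∫α₀, b = ∫α₁′, c = ∫α₀α₁′, r = ∫α₁′α₀, m = ∫Fα₀, where α₁′ = α₁ − dF; the hypothesis c + r = a·b is the shuffle relation.) -/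

import Mathlib

open scoped BigOperators

noncomputable section

/-- The relation on the free algebra whose `RingQuot` is the quotient by the two-sided
ideal generated by all products of `n+1` generators. -/
def truncRel (K : Type*) [CommRing K] (m n : ℕ) :
    FreeAlgebra K (Fin m) → FreeAlgebra K (Fin m) → Prop := fun x y =>
  (∃ f : Fin (n + 1) → Fin m,
      x = (List.ofFn fun t => FreeAlgebra.ι K (f t)).prod) ∧ y = 0

/-- The level-`n` truncated free algebra on `m` generators over `K`:
the quotient of the free associative algebra on `m` generators by the two-sided ideal
generated by all products of `n+1` generators. -/
abbrev TruncFreeAlgebra (K : Type*) [CommRing K] (m n : ℕ) : Type _ :=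
  RingQuot (truncRel K m n)

/-- The image `A_i` of the `i`-th generator in the truncated free algebra. -/
def gen (K : Type*) [CommRing K] (m n : ℕ) (i : Fin m) : TruncFreeAlgebra K m n :=
  RingQuot.mkAlgHom K (truncRel K m n) (FreeAlgebra.ι K i)

/-- The commutator `[x,y] = x*y - y*x`. -/
def br {R : Type*} [Ring R] (x y : R) : R := x * y - y * x

/-- The truncated exponential `exp_N(x) = ∑_{k=0}^{N} x^k / k!`. -/
def expT (K : Type*) {R : Type*} [Field K] [Ring R] [Algebra K R] (N : ℕ) (x : R) : R :=
  ∑ k ∈ Finset.range (N + 1), (k.factorial : K)⁻¹ • x ^ k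

theorem gen_triple (K : Type*) [CommRing K] (i j k : Fin 2) :
    gen K 2 2 i * (gen K 2 2 j * gen K 2 2 k) = 0 := by
  have h := RingQuot.mkAlgHom_rel K (s := truncRel K 2 2)
    (x := (List.ofFn fun t => FreeAlgebra.ι K ((![i, j, k] : Fin 3 → Fin 2) t)).prod) (y := 0)
    ⟨⟨![i, j, k], rfl⟩, rfl⟩
  simpa [gen, List.ofFn_succ] using h

theorem expT_two {K R : Type*} [Field K] [Ring R] [Algebra K R] (x : R) :
    expT K 2 x = 1 + x + (2 : K)⁻¹ • (x * x) := by
  simp [expT, Finset.sum_range_succ, pow_two, Nat.factorial]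

theorem factor_aux {K R : Type*} [Field K] [CharZero K] [Ring R] [Algebra K R]
    (a b c m r : K) (hs : c + r = a * b) (g : Fin 2 → R)
    (h : ∀ i j k, g i * (g j * g k) = 0) :
    (1 : R) + a • g 0 + b • g 1
        + (a ^ 2 / 2) • (g 0 * g 0) + (c + m) • (g 0 * g 1)
        + (r - m) • (g 1 * g 0) + (b ^ 2 / 2) • (g 1 * g 1)
      = expT K 2 (b • g 1) * expT K 2 (a • g 0 + (c + m) • br (g 0) (g 1)) := by
  obtain rfl : r = a * b - c := by linear_combination hs
  rw [expT_two, expT_two]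
  simp only [br, mul_add, add_mul, mul_sub, sub_mul, smul_sub, smul_add, mul_smul_comm,
    smul_mul_assoc, mul_assoc, h, mul_zero, smul_zero, sub_zero, add_zero, zero_add, mul_one,
    one_mul]
  module

/-- the factorization underlying the level-2 de Rham unipotent Albanese map
on an elliptic curve with tangential basepoint at infinity, as an identity in the level-2
truncated free algebra `R₂` on two generators `A₀, A₁` over a field `K` of characteristic
zero, where `c + r = a·b` is the shuffle relation. -/
theorem level2_elliptic_tangential_period_map_factorization
    (K : Type*) [Field K] [CharZero K] (a b c m r : K)
    (hshuffle : c + r = a * b) :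
    let A0 := gen K 2 2 0
    let A1 := gen K 2 2 1
    (1 : TruncFreeAlgebra K 2 2)
        + a • A0 + b • A1
        + (a ^ 2 / 2) • (A0 * A0) + (c + m) • (A0 * A1)
        + (r - m) • (A1 * A0) + (b ^ 2 / 2) • (A1 * A1)
      =
      expT K 2 (b • A1) * expT K 2 (a • A0 + (c + m) • br A0 A1) := by
  intro A0 A1
  exact factor_aux a b c m r hshuffle (gen K 2 2) (gen_triple K)
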